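/- Let M be a positive integer and q ∈ (1, M+1]. If for every r ∈ (q, M+1] the Hausdorff dimension of π_{M+1}(U'_r \ U'_q) is strictly positive, then q ∈ U, i.e., 1 has a unique q-expansion. -/

import Mathlib

open Set MeasureTheory Filter

noncomputable section

/-- The projection `π_q` of a digit sequence (0-indexed): `∑ d i / q^(i+1)`. -/
def piQ (q : ℝ) (d : ℕ → ℕ) : ℝ := ∑' i : ℕ, (d i : ℝ) / q ^ (i + 1)

/-- `d` is a `q`-expansion of `x` over the alphabet `{0,…,M}`. -/
def IsExpansion (M : ℕ) (q x : ℝ) (d : ℕ → ℕ) : Prop :=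
  (∀ i, d i ≤ M) ∧ piQ q d = x

/-- `U'_q`: digit sequences that are the unique `q`-expansion of their projection. -/
def UnivSeqs (M : ℕ) (q : ℝ) : Set (ℕ → ℕ) :=
  {d | (∀ i, d i ≤ M) ∧ ∀ e : ℕ → ℕ, IsExpansion M q (piQ q d) e → e = d}

/-- The set `U = U(M)` of univoque bases: `q ∈ (1, M+1]` such that `1` has a
unique `q`-expansion over `{0,…,M}`. -/
def UnivBases (M : ℕ) : Set ℝ :=
  {q | 1 < q ∧ q ≤ M + 1 ∧ ∃! d : ℕ → ℕ, IsExpansion M q 1 d}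

/-- The Komornik–Loreti constant `q'(M) = min U(M)`. -/
def KL (M : ℕ) : ℝ := sInf (UnivBases M)

/-- `(a, b)` is a connected component of `(q'(M), M+1) \ closure (U(M))`:
an open subinterval whose endpoints do not lie in that (open) set. -/
def CC (M : ℕ) (a b : ℝ) : Prop :=
  a < b ∧ Ioo a b ⊆ Ioo (KL M) (M + 1) \ closure (UnivBases M) ∧
    a ∉ Ioo (KL M) (M + 1) \ closure (UnivBases M) ∧
    b ∉ Ioo (KL M) (M + 1) \ closure (UnivBases M)

/-- `x ∈ [0, M/(q-1)]` has exactly two distinct `q`-expansions. -/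
def HasExactlyTwoExpansions (M : ℕ) (q x : ℝ) : Prop :=
  ∃ c d : ℕ → ℕ, c ≠ d ∧ IsExpansion M q x c ∧ IsExpansion M q x d ∧
    ∀ e : ℕ → ℕ, IsExpansion M q x e → e = c ∨ e = d

/-- `B_2(M)`: bases `q ∈ (1, M+1]` for which some `x ∈ [0, M/(q-1)]` has exactly
two `q`-expansions. -/
def B2 (M : ℕ) : Set ℝ :=
  {q | 1 < q ∧ q ≤ M + 1 ∧
    ∃ x ∈ Icc (0 : ℝ) (M / (q - 1)), HasExactlyTwoExpansions M q x}

/-- Strict lexicographic order on digit sequences. -/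
def seqLt (a b : ℕ → ℕ) : Prop := ∃ n, (∀ i < n, a i = b i) ∧ a n < b n

/-- Lexicographic order on digit sequences. -/
def seqLe (a b : ℕ → ℕ) : Prop := seqLt a b ∨ a = b

/-- A digit sequence is infinite if it does not end with `0^∞` after a last
nonzero digit (in particular `0^∞` is infinite). -/
def IsInfiniteSeq (a : ℕ → ℕ) : Prop := ¬∃ m, a m ≠ 0 ∧ ∀ i > m, a i = 0

/-- `a = α(q)`, the quasi-greedy `q`-expansion of `1`: the lexicographically
largest infinite `q`-expansion of `1`. -/
def IsQuasiGreedy (M : ℕ) (q : ℝ) (a : ℕ → ℕ) : Prop :=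
  IsExpansion M q 1 a ∧ IsInfiniteSeq a ∧
    ∀ b : ℕ → ℕ, IsExpansion M q 1 b → IsInfiniteSeq b → seqLe b a

/-- `b = β(q)`, the greedy `q`-expansion of `1`: the lexicographically largest
`q`-expansion of `1`. -/
def IsGreedy (M : ℕ) (q : ℝ) (b : ℕ → ℕ) : Prop :=
  IsExpansion M q 1 b ∧ ∀ c : ℕ → ℕ, IsExpansion M q 1 c → seqLe c b

/-- `w⁺`: increase the last digit of a word by one. -/
def plusWord : List ℕ → List ℕ
  | [] => []
  | [a] => [a + 1]
  | a :: b :: rest => a :: plusWord (b :: rest)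

/-- `w⁻`: decrease the last digit of a word by one. -/
def minusWord : List ℕ → List ℕ
  | [] => []
  | [a] => [a - 1]
  | a :: b :: rest => a :: minusWord (b :: rest)

/-- The reflection of a word: `\overline{w} = (M - w_1) ⋯ (M - w_k)`. -/
def reflWord (M : ℕ) (w : List ℕ) : List ℕ := w.map fun a => M - a

/-- The substitution `g(w) = w⁺ \overline{w⁺}`. -/
def gWord (M : ℕ) (w : List ℕ) : List ℕ := plusWord w ++ reflWord M (plusWord w)

/-- The periodic sequence `t^∞` determined by a word `t`. -/
def periodicSeq (t : List ℕ) (i : ℕ) : ℕ := t.getD (i % t.length) 0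

/-- Strict lexicographic order on words. -/
def wordLt (u v : List ℕ) : Prop := List.Lex (· < ·) u v

/-- Lexicographic order on words. -/
def wordLe (u v : List ℕ) : Prop := wordLt u v ∨ u = v

/-- The connected component `(q_0, q_0^*)` of `(q'(M), M+1) \ closure (U(M))` is
generated by the word `t`, and `θ = α(q_0^*)`: `α(q_0) = t^∞` and
`α(q_0^*) = lim_{n→∞} g^n(t)`, i.e. every `g^n(t)` is a prefix of `θ`. -/
def GeneratedBy (M : ℕ) (q₀ q₀star : ℝ) (t : List ℕ) (θ : ℕ → ℕ) : Prop :=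
  CC M q₀ q₀star ∧ t ≠ [] ∧ IsQuasiGreedy M q₀ (periodicSeq t) ∧
    IsQuasiGreedy M q₀star θ ∧
    ∀ n : ℕ, ∀ i < ((gWord M)^[n] t).length, ((gWord M)^[n] t).getD i 0 = θ i


/-- The left shift of a sequence by `n` places. -/
def shiftSeq (n : ℕ) (d : ℕ → ℕ) : ℕ → ℕ := fun i => d (i + n)

/-- The digitwise reflection `d ↦ M - d` of a sequence. -/
def reflSeq (M : ℕ) (d : ℕ → ℕ) : ℕ → ℕ := fun i => M - d i

/-- Numerical criterion for `d` to be a unique `q`-expansion: after a digit that can be raised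
(lowered) the tail (reflected tail) has value less than `1`. -/
def StrictCond (M : ℕ) (q : ℝ) (d : ℕ → ℕ) : Prop :=
  (∀ i, d i ≤ M) ∧ ∀ n, (d n < M → piQ q (shiftSeq (n + 1) d) < 1) ∧
    (0 < d n → piQ q (reflSeq M (shiftSeq (n + 1) d)) < 1)

/-- The weak form of `StrictCond`. -/
def WeakCond (M : ℕ) (q : ℝ) (d : ℕ → ℕ) : Prop :=
  (∀ i, d i ≤ M) ∧ ∀ n, (d n < M → piQ q (shiftSeq (n + 1) d) ≤ 1) ∧
    (0 < d n → piQ q (reflSeq M (shiftSeq (n + 1) d)) ≤ 1)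

theorem shiftSeq_shiftSeq (m n : ℕ) (d : ℕ → ℕ) :
    shiftSeq m (shiftSeq n d) = shiftSeq (m + n) d := by
  funext i
  simp [shiftSeq, add_assoc]

theorem shiftSeq_zero (d : ℕ → ℕ) : shiftSeq 0 d = d := rfl

theorem reflSeq_reflSeq {M : ℕ} {d : ℕ → ℕ} (hd : ∀ i, d i ≤ M) :
    reflSeq M (reflSeq M d) = d := by
  funext i
  have := hd i
  simp only [reflSeq]
  omega

theorem hasSum_geometric_tail {q : ℝ} (hq : 1 < q) (M : ℕ) :
    HasSum (fun i : ℕ => (M : ℝ) / q ^ (i + 1)) (M / (q - 1)) := by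
  have h := (hasSum_geometric_of_lt_one (r := q⁻¹) (by positivity)
    (inv_lt_one_of_one_lt₀ hq)).mul_left ((M : ℝ) / q)
  have h1 : q ≠ 0 := by positivity
  have h2 : q - 1 ≠ 0 := by linarith
  have h3 : (fun i : ℕ => (M : ℝ) / q ^ (i + 1)) = fun i => (M : ℝ) / q * q⁻¹ ^ i := by
    funext i
    rw [pow_succ, inv_pow]
    field_simp
  have h4 : (M : ℝ) / (q - 1) = M / q * (1 - q⁻¹)⁻¹ := by
    have h5 : 1 - q⁻¹ = (q - 1) / q := by field_simp
    rw [h5]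
    field_simp
  rw [h3, h4]
  exact h

theorem summable_piQ {M : ℕ} {q : ℝ} (hq : 1 < q) {d : ℕ → ℕ} (hd : ∀ i, d i ≤ M) :
    Summable fun i : ℕ => (d i : ℝ) / q ^ (i + 1) := by
  refine Summable.of_nonneg_of_le (fun i => by positivity) (fun i => ?_)
    (hasSum_geometric_tail hq M).summable
  have : (d i : ℝ) ≤ M := by exact_mod_cast hd i
  gcongr

theorem piQ_nonneg {q : ℝ} (hq : 1 < q) (d : ℕ → ℕ) : 0 ≤ piQ q d :=
  tsum_nonneg fun i => by positivity

theorem piQ_reflSeq {M : ℕ} {q : ℝ} (hq : 1 < q) {d : ℕ → ℕ} (hd : ∀ i, d i ≤ M) :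
    piQ q (reflSeq M d) = M / (q - 1) - piQ q d := by
  rw [← (hasSum_geometric_tail hq M).tsum_eq, piQ, piQ,
    ← (hasSum_geometric_tail hq M).summable.tsum_sub (summable_piQ hq hd)]
  refine tsum_congr fun i => ?_
  rw [reflSeq, Nat.cast_sub (hd i), sub_div]

theorem piQ_le {M : ℕ} {q : ℝ} (hq : 1 < q) {d : ℕ → ℕ} (hd : ∀ i, d i ≤ M) :
    piQ q d ≤ M / (q - 1) := by
  have h := piQ_nonneg hq (reflSeq M d)
  rw [piQ_reflSeq hq hd] at h
  linarith

theorem piQ_split {M : ℕ} {q : ℝ} (hq : 1 < q) {d : ℕ → ℕ} (hd : ∀ i, d i ≤ M) (n : ℕ) :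
    piQ q d = ∑ i ∈ Finset.range n, (d i : ℝ) / q ^ (i + 1) + piQ q (shiftSeq n d) / q ^ n := by
  rw [piQ, ← (summable_piQ hq hd).sum_add_tsum_nat_add n, piQ, ← tsum_div_const]
  congr 1
  refine tsum_congr fun i => ?_
  rw [shiftSeq, div_div, ← pow_add]
  congr 2
  omega

theorem piQ_shiftSeq_succ {M : ℕ} {q : ℝ} (hq : 1 < q) {d : ℕ → ℕ} (hd : ∀ i, d i ≤ M) (n : ℕ) :
    piQ q (shiftSeq (n + 1) d) = q * piQ q (shiftSeq n d) - d n := by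
  have h := piQ_split hq (d := shiftSeq n d) (fun i => hd _) 1
  have h1 : q ≠ 0 := by positivity
  rw [shiftSeq_shiftSeq, add_comm 1 n] at h
  rw [h]
  simp [shiftSeq]
  field_simp
  ring

theorem exists_expansion {M : ℕ} {q : ℝ} (hq : 1 < q) (hqM : q ≤ M + 1) {x : ℝ}
    (hx0 : 0 ≤ x) (hx1 : x ≤ M / (q - 1)) : ∃ d, IsExpansion M q x d := by
  have hq1 : 0 < q - 1 := by linarith
  have hq0 : 0 < q := by linarith
  set f : ℝ → ℕ := fun y => min M ⌊q * y⌋₊ with hf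
  set X : ℕ → ℝ := fun n => (fun y => q * y - f y)^[n] x with hX
  have hsucc : ∀ n, X (n + 1) = q * X n - f (X n) := fun n => by
    simp only [hX, Function.iterate_succ_apply']
  have hXI : ∀ n, 0 ≤ X n ∧ X n ≤ M / (q - 1) := by
    intro n
    induction n with
    | zero => exact ⟨hx0, hx1⟩
    | succ n ih =>
      rw [hsucc]
      have hqy : 0 ≤ q * X n := mul_nonneg hq0.le ih.1
      have h1 := Nat.floor_le hqy
      have h2 := Nat.lt_floor_add_one (q * X n)
      have h3 : (1 : ℝ) ≤ M / (q - 1) := by rw [le_div_iff₀ hq1]; linarith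
      rcases le_total M ⌊q * X n⌋₊ with h | h
      · have h4 : f (X n) = M := min_eq_left h
        have h5 : (M : ℝ) ≤ ⌊q * X n⌋₊ := by exact_mod_cast h
        rw [h4]
        refine ⟨by linarith, ?_⟩
        have h6 : q * X n ≤ q * (M / (q - 1)) := by gcongr; exact ih.2
        have h7 : q * ((M : ℝ) / (q - 1)) - M = M / (q - 1) := by field_simp; ring
        linarith
      · have h4 : f (X n) = ⌊q * X n⌋₊ := min_eq_right h
        rw [h4]
        constructor <;> linarith
  have hd : ∀ i, f (X i) ≤ M := fun i => min_le_left _ _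
  refine ⟨fun i => f (X i), hd, ?_⟩
  have hpart : ∀ n, ∑ i ∈ Finset.range n, (f (X i) : ℝ) / q ^ (i + 1) = x - X n / q ^ n := by
    intro n
    induction n with
    | zero => simp [hX]
    | succ n ih =>
      rw [Finset.sum_range_succ, ih, hsucc]
      field_simp
      ring
  have hlim : Tendsto (fun n => x - X n / q ^ n) atTop (nhds (x - 0)) := by
    refine tendsto_const_nhds.sub ?_
    refine squeeze_zero (g := fun n => (M / (q - 1)) / q ^ n)
      (fun n => div_nonneg (hXI n).1 (by positivity))
      (fun n => div_le_div_of_nonneg_right (hXI n).2 (by positivity)) ?_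
    exact tendsto_const_nhds.div_atTop (tendsto_pow_atTop_atTop_of_one_lt hq)
  have hsum := (summable_piQ hq hd).hasSum.tendsto_sum_nat
  simp only [hpart] at hsum
  rw [sub_zero] at hlim
  exact tendsto_nhds_unique hsum hlim

theorem StrictCond.mem_univSeqs {M : ℕ} {q : ℝ} (hq : 1 < q) {d : ℕ → ℕ}
    (h : StrictCond M q d) : d ∈ UnivSeqs M q := by
  refine ⟨h.1, fun e he => ?_⟩
  by_contra hne
  obtain ⟨heM, hpi⟩ := he
  have hex : ∃ n, e n ≠ d n := Function.ne_iff.1 hne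
  classical
  have hn := Nat.find_spec hex
  have hlt : ∀ i < Nat.find hex, e i = d i := fun i hi => not_not.1 (Nat.find_min hex hi)
  generalize Nat.find hex = n at hn hlt
  have hq0 : 0 < q ^ n := by positivity
  have htail : piQ q (shiftSeq n e) = piQ q (shiftSeq n d) := by
    rw [piQ_split hq heM n, piQ_split hq h.1 n,
      Finset.sum_congr rfl fun i hi => by rw [hlt i (Finset.mem_range.1 hi)]] at hpi
    have := add_left_cancel hpi
    field_simp at this
    exact this
  have h1 := piQ_shiftSeq_succ hq heM n
  have h2 := piQ_shiftSeq_succ hq h.1 n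
  rw [htail] at h1
  rcases lt_or_gt_of_ne hn with hn | hn
  · have h3 := (h.2 n).2 (by omega)
    rw [piQ_reflSeq hq (d := shiftSeq (n + 1) d) fun i => h.1 _] at h3
    have h4 := piQ_le hq (d := shiftSeq (n + 1) e) fun i => heM _
    have h5 : (e n : ℝ) + 1 ≤ d n := by exact_mod_cast hn
    linarith
  · have h3 := (h.2 n).1 (by have := heM n; omega)
    have h4 := piQ_nonneg hq (shiftSeq (n + 1) e)
    have h5 : (d n : ℝ) + 1 ≤ e n := by exact_mod_cast hn
    linarith

/-- In a unique expansion no digit can be changed with the remainder staying admissible. -/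
theorem eq_digit_of_mem_univSeqs {M : ℕ} {q : ℝ} (hq : 1 < q) (hqM : q ≤ M + 1) {d : ℕ → ℕ}
    (h : d ∈ UnivSeqs M q) (n c : ℕ) (hc : c ≤ M)
    (h0 : 0 ≤ d n + piQ q (shiftSeq (n + 1) d) - c)
    (h1 : d n + piQ q (shiftSeq (n + 1) d) - c ≤ M / (q - 1)) : c = d n := by
  obtain ⟨e, heM, he⟩ := exists_expansion hq hqM h0 h1
  set g : ℕ → ℕ := fun i => if i < n then d i else if i = n then c else e (i - (n + 1)) with hg
  have hgM : ∀ i, g i ≤ M := by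
    intro i
    simp only [hg]
    split_ifs
    exacts [h.1 i, hc, heM _]
  have hgn : g n = c := by simp [hg]
  have hgs : shiftSeq (n + 1) g = e := by
    funext i
    have h2 : ¬ i + (n + 1) < n := by omega
    have h3 : ¬ i + (n + 1) = n := by omega
    simp [shiftSeq, hg, h2, h3]
  have hgl : ∀ i ∈ Finset.range n, (g i : ℝ) / q ^ (i + 1) = (d i : ℝ) / q ^ (i + 1) := by
    intro i hi
    simp [hg, Finset.mem_range.1 hi]
  have hpi : piQ q g = piQ q d := by
    rw [piQ_split hq hgM (n + 1), piQ_split hq h.1 (n + 1), Finset.sum_range_succ,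
      Finset.sum_range_succ, Finset.sum_congr rfl hgl, hgs, hgn, he]
    ring
  have := h.2 g ⟨hgM, hpi⟩
  rw [← hgn, this]

theorem strictCond_of_mem_univSeqs {M : ℕ} {q : ℝ} (hq : 1 < q) (hqM : q ≤ M + 1) {d : ℕ → ℕ}
    (h : d ∈ UnivSeqs M q) : StrictCond M q d := by
  refine ⟨h.1, fun n => ⟨fun hn => ?_, fun hn => ?_⟩⟩
  · by_contra! hge
    have hle := piQ_le hq (d := shiftSeq (n + 1) d) fun i => h.1 _
    have := eq_digit_of_mem_univSeqs hq hqM h n (d n + 1) hn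
      (by push_cast; linarith) (by push_cast; linarith)
    omega
  · by_contra! hge
    rw [piQ_reflSeq hq (d := shiftSeq (n + 1) d) fun i => h.1 _] at hge
    have h0 := piQ_nonneg hq (shiftSeq (n + 1) d)
    have hcast : ((d n - 1 : ℕ) : ℝ) = d n - 1 := by rw [Nat.cast_sub hn, Nat.cast_one]
    have := eq_digit_of_mem_univSeqs hq hqM h n (d n - 1) (by have := h.1 n; omega)
      (by rw [hcast]; linarith) (by rw [hcast]; linarith)
    omega

theorem StrictCond.weakCond {M : ℕ} {q : ℝ} {d : ℕ → ℕ} (h : StrictCond M q d) :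
    WeakCond M q d :=
  ⟨h.1, fun n => ⟨fun hn => ((h.2 n).1 hn).le, fun hn => ((h.2 n).2 hn).le⟩⟩

theorem StrictCond.shiftSeq {M : ℕ} {q : ℝ} {d : ℕ → ℕ} (h : StrictCond M q d) (m : ℕ) :
    StrictCond M q (shiftSeq m d) := by
  refine ⟨fun i => h.1 _, fun n => ?_⟩
  rw [shiftSeq_shiftSeq, add_right_comm]
  exact h.2 (n + m)

theorem WeakCond.shiftSeq {M : ℕ} {q : ℝ} {d : ℕ → ℕ} (h : WeakCond M q d) (m : ℕ) :
    WeakCond M q (shiftSeq m d) := by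
  refine ⟨fun i => h.1 _, fun n => ?_⟩
  rw [shiftSeq_shiftSeq, add_right_comm]
  exact h.2 (n + m)

theorem StrictCond.reflSeq {M : ℕ} {q : ℝ} {d : ℕ → ℕ} (h : StrictCond M q d) :
    StrictCond M q (reflSeq M d) := by
  refine ⟨fun i => Nat.sub_le _ _, fun n => ⟨fun hn => ?_, fun hn => ?_⟩⟩
  · exact (h.2 n).2 (by simp only [_root_.reflSeq] at hn; omega)
  · have h1 := (h.2 n).1 (by simp only [_root_.reflSeq] at hn; omega)
    rwa [← reflSeq_reflSeq (d := _root_.shiftSeq (n + 1) d) fun i => h.1 _] at h1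

theorem WeakCond.reflSeq {M : ℕ} {q : ℝ} {d : ℕ → ℕ} (h : WeakCond M q d) :
    WeakCond M q (reflSeq M d) := by
  refine ⟨fun i => Nat.sub_le _ _, fun n => ⟨fun hn => ?_, fun hn => ?_⟩⟩
  · exact (h.2 n).2 (by simp only [_root_.reflSeq] at hn; omega)
  · have h1 := (h.2 n).1 (by simp only [_root_.reflSeq] at hn; omega)
    rwa [← reflSeq_reflSeq (d := _root_.shiftSeq (n + 1) d) fun i => h.1 _] at h1

theorem StrictCond.piQ_shiftSeq_lt_one {M : ℕ} {q : ℝ} (hq : 1 < q) (hqM : q ≤ M + 1)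
    {d : ℕ → ℕ} (h : StrictCond M q d) (h1 : piQ q d < 1) (n : ℕ) :
    piQ q (_root_.shiftSeq n d) < 1 := by
  induction n with
  | zero => exact h1
  | succ n ih =>
    rcases (h.1 n).lt_or_eq with hn | hn
    · exact (h.2 n).1 hn
    · rw [piQ_shiftSeq_succ hq h.1, hn]
      nlinarith

theorem WeakCond.piQ_shiftSeq_le_one {M : ℕ} {q : ℝ} (hq : 1 < q) (hqM : q ≤ M + 1)
    {d : ℕ → ℕ} (h : WeakCond M q d) (h1 : piQ q d ≤ 1) (n : ℕ) :
    piQ q (_root_.shiftSeq n d) ≤ 1 := by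
  induction n with
  | zero => exact h1
  | succ n ih =>
    rcases (h.1 n).lt_or_eq with hn | hn
    · exact (h.2 n).1 hn
    · rw [piQ_shiftSeq_succ hq h.1, hn]
      nlinarith

theorem WeakCond.piQ_shiftSeq_pos {M : ℕ} {q : ℝ} (hq : 1 < q) (hqM : q < M + 1)
    {d : ℕ → ℕ} (h : WeakCond M q d) (h1 : 0 < piQ q d) (n : ℕ) :
    0 < piQ q (_root_.shiftSeq n d) := by
  induction n with
  | zero => exact h1
  | succ n ih =>
    rcases Nat.eq_zero_or_pos (d n) with hn | hn
    · rw [piQ_shiftSeq_succ hq h.1, hn]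
      have : 0 < q * piQ q (_root_.shiftSeq n d) := by positivity
      simpa using this
    · have h2 := (h.2 n).2 hn
      rw [piQ_reflSeq hq (d := _root_.shiftSeq (n + 1) d) fun i => h.1 _] at h2
      have h3 : (1 : ℝ) < M / (q - 1) := by rw [lt_div_iff₀ (by linarith)]; linarith
      linarith

/-- There is at most one weakly univoque expansion of `1`. -/
theorem WeakCond.eq_of_piQ_eq_one {M : ℕ} {q : ℝ} (hq : 1 < q) (hqM : q < M + 1)
    {d e : ℕ → ℕ} (hd : WeakCond M q d) (he : WeakCond M q e)
    (hd1 : piQ q d = 1) (he1 : piQ q e = 1) : d = e := by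
  have hdigit : ∀ n, piQ q (_root_.shiftSeq n d) = piQ q (_root_.shiftSeq n e) → d n = e n := by
    intro n hn
    have a1 := hd.piQ_shiftSeq_le_one hq hqM.le hd1.le (n + 1)
    have a2 := he.piQ_shiftSeq_le_one hq hqM.le he1.le (n + 1)
    have b1 := hd.piQ_shiftSeq_pos hq hqM (by linarith) (n + 1)
    have b2 := he.piQ_shiftSeq_pos hq hqM (by linarith) (n + 1)
    rw [piQ_shiftSeq_succ hq hd.1] at a1 b1
    rw [piQ_shiftSeq_succ hq he.1] at a2 b2
    rw [hn] at a1 b1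
    have c1 : (d n : ℝ) < (e n + 1 : ℕ) := by push_cast; linarith
    have c2 : (e n : ℝ) < (d n + 1 : ℕ) := by push_cast; linarith
    have c1' : d n < e n + 1 := by exact_mod_cast c1
    have c2' : e n < d n + 1 := by exact_mod_cast c2
    omega
  have htail : ∀ n, piQ q (_root_.shiftSeq n d) = piQ q (_root_.shiftSeq n e) := by
    intro n
    induction n with
    | zero => exact hd1.trans he1.symm
    | succ n ih =>
      rw [piQ_shiftSeq_succ hq hd.1, piQ_shiftSeq_succ hq he.1, ih, hdigit n ih]
  exact funext fun n => hdigit n (htail n)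

theorem mem_univBases_of_strictCond {M : ℕ} {q : ℝ} (hq : 1 < q) (hqM : q ≤ M + 1)
    {d : ℕ → ℕ} (h : StrictCond M q d) (h1 : piQ q d = 1) : q ∈ UnivBases M :=
  ⟨hq, hqM, d, ⟨h.1, h1⟩, fun e he => (h.mem_univSeqs hq).2 e (h1.symm ▸ he)⟩

theorem add_one_mem_univBases {M : ℕ} (hM : 0 < M) : (M : ℝ) + 1 ∈ UnivBases M := by
  have hM' : (0 : ℝ) < M := by exact_mod_cast hM
  have hq : (1 : ℝ) < M + 1 := by linarith
  have hval : piQ ((M : ℝ) + 1) (fun _ => M) = 1 := by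
    rw [piQ, (hasSum_geometric_tail hq M).tsum_eq, add_sub_cancel_right, div_self hM'.ne']
  refine mem_univBases_of_strictCond hq le_rfl
    ⟨fun _ => le_rfl, fun n => ⟨fun hn => (lt_irrefl _ hn).elim, fun _ => ?_⟩⟩ hval
  simp [reflSeq, shiftSeq, piQ]

/-- A weakly univoque expansion of `1` in a base that is not univoque is periodic. -/
theorem WeakCond.exists_period {M : ℕ} {q : ℝ} (hq : 1 < q) (hqM : q < M + 1)
    (hqU : q ∉ UnivBases M) {a : ℕ → ℕ} (ha : WeakCond M q a) (ha1 : piQ q a = 1) :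
    ∃ m, 0 < m ∧ _root_.shiftSeq m a = a := by
  have hns : ¬ StrictCond M q a := fun h => hqU (mem_univBases_of_strictCond hq hqM.le h ha1)
  have hex : ∃ n, (a n < M ∧ 1 ≤ piQ q (_root_.shiftSeq (n + 1) a)) ∨
      (0 < a n ∧ 1 ≤ piQ q (_root_.reflSeq M (_root_.shiftSeq (n + 1) a))) := by
    by_contra! hcon
    exact hns ⟨ha.1, hcon⟩
  obtain ⟨n, ⟨hn, h1⟩ | ⟨hn, h1⟩⟩ := hex
  · exact ⟨n + 1, n.succ_pos, (ha.shiftSeq (n + 1)).eq_of_piQ_eq_one hq hqM ha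
      (le_antisymm ((ha.2 n).1 hn) h1) ha1⟩
  · have h2 := (ha.shiftSeq (n + 1)).reflSeq.eq_of_piQ_eq_one hq hqM ha
      (le_antisymm ((ha.2 n).2 hn) h1) ha1
    refine ⟨(n + 1) + (n + 1), by omega, ?_⟩
    rw [← shiftSeq_shiftSeq]
    have h3 : _root_.shiftSeq (n + 1) a = _root_.reflSeq M a := by
      rw [← reflSeq_reflSeq (d := _root_.shiftSeq (n + 1) a) fun i => ha.1 _, h2]
    rw [h3]
    exact h2

theorem tendsto_piQ {M : ℕ} {q : ℝ} (hq : 1 < q) {r : ℕ → ℝ} {y : ℕ → ℕ → ℕ} {z : ℕ → ℕ}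
    (hr : ∀ k, q ≤ r k) (hrq : Tendsto r atTop (nhds q)) (hy : ∀ k i, y k i ≤ M)
    (hyz : Tendsto y atTop (nhds z)) :
    Tendsto (fun k => piQ (r k) (y k)) atTop (nhds (piQ q z)) := by
  have hq0 : 0 < q := by linarith
  refine tendsto_tsum_of_dominated_convergence (bound := fun i => (M : ℝ) / q ^ (i + 1))
    (hasSum_geometric_tail hq M).summable (fun i => ?_) (Eventually.of_forall fun k i => ?_)
  · have h1 : Tendsto (fun k => ((y k i : ℕ) : ℝ)) atTop (nhds (z i : ℝ)) :=
      (continuous_of_discreteTopology.tendsto (z i)).comp ((tendsto_pi_nhds.1 hyz) i)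
    exact h1.div (hrq.pow _) (by positivity)
  · have h0 : 0 < r k := hq0.trans_le (hr k)
    have h1 : (y k i : ℝ) ≤ M := by exact_mod_cast hy k i
    have h2 := hr k
    rw [Real.norm_of_nonneg (by positivity)]
    gcongr

theorem continuous_shiftSeq (n : ℕ) : Continuous (shiftSeq n) :=
  continuous_pi fun i => continuous_apply (i + n)

theorem continuous_reflSeq (M : ℕ) : Continuous (reflSeq M) :=
  continuous_pi fun i => continuous_of_discreteTopology.comp (continuous_apply i)

theorem isCompact_digitSeqs (M : ℕ) : IsCompact {d : ℕ → ℕ | ∀ i, d i ≤ M} := by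
  have h := isCompact_univ_pi fun _ : ℕ => (Set.finite_Iic M).isCompact
  convert h using 1
  ext d
  simp only [Set.mem_univ_pi, Set.mem_Iic, Set.mem_ofPred_eq]

/-- For bases slightly larger than `q`, every univoque sequence of value at least `1` in base `q`
and less than `1` in the larger base is close to a weakly univoque `q`-expansion of `1`. -/
theorem exists_base_forall_mem {M : ℕ} {q : ℝ} (hq : 1 < q) (hqM : q < M + 1)
    {S : Set (ℕ → ℕ)} (hS : IsOpen S) (hW : ∀ y, WeakCond M q y → piQ q y = 1 → y ∈ S) :
    ∃ r ∈ Ioc q ((M : ℝ) + 1), ∀ y, StrictCond M r y → 1 ≤ piQ q y → piQ r y < 1 → y ∈ S := by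
  by_contra! hcon
  have hc : 0 < (M : ℝ) + 1 - q := by linarith
  set r : ℕ → ℝ := fun k => q + ((M : ℝ) + 1 - q) * (1 / ((k : ℝ) + 1)) with hr
  have hrmem : ∀ k, r k ∈ Ioc q ((M : ℝ) + 1) := by
    intro k
    have h1 : (0 : ℝ) < 1 / ((k : ℝ) + 1) := by positivity
    have h2 : (1 : ℝ) / ((k : ℝ) + 1) ≤ 1 := by
      rw [div_le_one (by positivity)]
      have : (0 : ℝ) ≤ k := by positivity
      linarith
    constructor
    · have := mul_pos hc h1
      simp only [hr]; linarith
    · have := mul_le_mul_of_nonneg_left h2 hc.le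
      simp only [hr]; linarith
  have hrlim : Tendsto r atTop (nhds q) := by
    have := (tendsto_one_div_add_atTop_nhds_zero_nat (𝕜 := ℝ)).const_mul ((M : ℝ) + 1 - q)
    simpa [hr] using this.const_add q
  choose y hyS hy1 hyr hyn using fun k => hcon (r k) (hrmem k)
  obtain ⟨z, hzM, φ, hφ, hz⟩ := (isCompact_digitSeqs M).tendsto_subseq fun k => (hyS k).1
  have hrφ : Tendsto (fun k => r (φ k)) atTop (nhds q) := hrlim.comp hφ.tendsto_atTop
  have hrle : ∀ k, q ≤ r (φ k) := fun k => (hrmem _).1.le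
  have hev : ∀ n, ∀ᶠ k in atTop, y (φ k) n = z n := by
    intro n
    have := (tendsto_pi_nhds.1 hz) n
    rw [nhds_discrete, tendsto_pure] at this
    exact this
  have hzw : WeakCond M q z := by
    refine ⟨hzM, fun n => ⟨fun hn => ?_, fun hn => ?_⟩⟩
    · refine le_of_tendsto (tendsto_piQ (M := M) (y := fun k => shiftSeq (n + 1) (y (φ k)))
        hq hrle hrφ (fun k i => (hyS _).1 _) (((continuous_shiftSeq (n + 1)).tendsto z).comp hz)) ?_
      filter_upwards [hev n] with k hk
      exact (((hyS (φ k)).2 n).1 (hk ▸ hn)).le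
    · refine le_of_tendsto (tendsto_piQ (M := M)
        (y := fun k => reflSeq M (shiftSeq (n + 1) (y (φ k))))
        hq hrle hrφ (fun k i => Nat.sub_le _ _)
        ((((continuous_reflSeq M).comp (continuous_shiftSeq (n + 1))).tendsto z).comp hz)) ?_
      filter_upwards [hev n] with k hk
      exact (((hyS (φ k)).2 n).2 (hk ▸ hn)).le
  have hz1 : piQ q z = 1 := by
    refine le_antisymm ?_ ?_
    · exact le_of_tendsto (tendsto_piQ (M := M) hq hrle hrφ (fun k i => (hyS _).1 _) hz)
        (Eventually.of_forall fun k => (hyr (φ k)).le)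
    · exact ge_of_tendsto (tendsto_piQ (M := M) (r := fun _ => q) hq (fun _ => le_rfl)
        tendsto_const_nhds (fun k i => (hyS _).1 _) hz) (Eventually.of_forall fun k => hy1 (φ k))
  exact hS.isClosed_compl.mem_of_tendsto hz (Eventually.of_forall fun k => hyn (φ k))
    (hW z hzw hz1)

/-- For a base `q` that is not univoque and bases `r` slightly larger than `q`, at most one
`r`-univoque sequence has value at least `1` in base `q` and less than `1` in base `r`. -/
theorem exists_base_exists_forall_eq {M : ℕ} {q : ℝ} (hq : 1 < q) (hqM : q < M + 1)
    (hqU : q ∉ UnivBases M) : ∃ r ∈ Ioc q ((M : ℝ) + 1), ∃ a : ℕ → ℕ,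
      ∀ y, StrictCond M r y → 1 ≤ piQ q y → piQ r y < 1 → y = a := by
  by_cases hW : ∃ a, WeakCond M q a ∧ piQ q a = 1
  swap
  · push Not at hW
    obtain ⟨r, hr, h⟩ := exists_base_forall_mem hq hqM isOpen_empty
      fun y hy h1 => hW y hy h1
    exact ⟨r, hr, 0, fun y h1 h2 h3 => (h y h1 h2 h3).elim⟩
  obtain ⟨a, ha, ha1⟩ := hW
  obtain ⟨m, hm, hma⟩ := ha.exists_period hq hqM hqU ha1
  have hS : IsOpen {y : ℕ → ℕ | ∀ i ∈ Finset.range m, y i = a i} := by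
    simp only [Set.ofPred_forall]
    refine isOpen_biInter_finset fun i _ => ?_
    exact (isOpen_discrete ({a i} : Set ℕ)).preimage (continuous_apply (A := fun _ => ℕ) i)
  obtain ⟨r, hr, h⟩ := exists_base_forall_mem hq hqM hS fun y hy h1 i _ => by
    rw [hy.eq_of_piQ_eq_one hq hqM ha h1 ha1]
  have hr1 : 1 < r := hq.trans hr.1
  have hstep : ∀ y, StrictCond M r y → 1 ≤ piQ q y → piQ r y < 1 →
      1 ≤ piQ q (shiftSeq m y) ∧ piQ r (shiftSeq m y) < 1 := by
    intro y h1 h2 h3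
    refine ⟨?_, h1.piQ_shiftSeq_lt_one hr1 hr.2 h3 m⟩
    have h4 := h y h1 h2 h3
    have hq0 : 0 < q ^ m := by positivity
    rw [piQ_split hq h1.1 m, ← ha1, piQ_split hq ha.1 m, hma, ha1,
      Finset.sum_congr rfl fun i hi => by rw [← h4 i hi]] at h2
    have h5 := le_of_add_le_add_left h2
    rwa [div_le_div_iff_of_pos_right hq0] at h5
  have hall : ∀ k i, i < m → ∀ y, StrictCond M r y → 1 ≤ piQ q y → piQ r y < 1 →
      y (i + k * m) = a (i + k * m) := by
    intro k
    induction k with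
    | zero =>
      intro i hi y h1 h2 h3
      simpa using h y h1 h2 h3 i (Finset.mem_range.2 hi)
    | succ k ih =>
      intro i hi y h1 h2 h3
      obtain ⟨h4, h5⟩ := hstep y h1 h2 h3
      have h6 := ih i hi _ (h1.shiftSeq m) h4 h5
      have h7 := congrFun hma (i + k * m)
      simp only [shiftSeq] at h6 h7
      rw [show i + (k + 1) * m = i + k * m + m by ring, h6, h7]
  refine ⟨r, hr, a, fun y h1 h2 h3 => funext fun n => ?_⟩
  have := hall (n / m) (n % m) (Nat.mod_lt _ hm) y h1 h2 h3
  rwa [mul_comm, Nat.mod_add_div] at this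

theorem countable_setOf_shiftSeq_eq (a : ℕ → ℕ) : {x | ∃ n, shiftSeq n x = a}.Countable := by
  rw [Set.ofPred_exists]
  refine countable_iUnion fun n => ?_
  refine countable_of_injective_of_countable_image (f := fun (x : ℕ → ℕ) (i : Fin n) => x i)
    (fun x hx y hy hxy => ?_) (to_countable _)
  funext i
  rcases lt_or_ge i n with hi | hi
  · exact congrFun hxy ⟨i, hi⟩
  · have := congrFun (Eq.trans hx hy.symm) (i - n)
    simpa [shiftSeq, Nat.sub_add_cancel hi] using this

/-- If for every `r ∈ (q, M+1]` the Hausdorff dimension of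
`π_{M+1}(U'_r \ U'_q)` is strictly positive, then `q ∈ U`. -/
theorem stmt1 (M : ℕ) (hM : 0 < M) (q : ℝ) (hq : q ∈ Ioc 1 ((M : ℝ) + 1))
    (h : ∀ r ∈ Ioc q ((M : ℝ) + 1),
      0 < dimH (piQ ((M : ℝ) + 1) '' (UnivSeqs M r \ UnivSeqs M q))) :
    q ∈ UnivBases M := by
  by_contra hqU
  have hq1 : 1 < q := hq.1
  have hqM : q < M + 1 := lt_of_le_of_ne hq.2 fun heq => hqU (heq ▸ add_one_mem_univBases hM)
  obtain ⟨r, hr, a, ha⟩ := exists_base_exists_forall_eq hq1 hqM hqU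
  have hr1 : 1 < r := hq1.trans hr.1
  have hcount : (UnivSeqs M r \ UnivSeqs M q).Countable := by
    refine ((countable_setOf_shiftSeq_eq a).union
      (countable_setOf_shiftSeq_eq (reflSeq M a))).mono fun x hx => ?_
    have hxr := strictCond_of_mem_univSeqs hr1 hr.2 hx.1
    have hex : ∃ n, (x n < M ∧ 1 ≤ piQ q (shiftSeq (n + 1) x)) ∨
        (0 < x n ∧ 1 ≤ piQ q (reflSeq M (shiftSeq (n + 1) x))) := by
      by_contra! hcon
      exact hx.2 (StrictCond.mem_univSeqs hq1 ⟨hxr.1, hcon⟩)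
    obtain ⟨n, ⟨hn, h1⟩ | ⟨hn, h1⟩⟩ := hex
    · exact Or.inl ⟨n + 1, ha _ (hxr.shiftSeq _) h1 ((hxr.2 n).1 hn)⟩
    · refine Or.inr ⟨n + 1, ?_⟩
      rw [← ha _ (hxr.shiftSeq _).reflSeq h1 ((hxr.2 n).2 hn),
        reflSeq_reflSeq (d := shiftSeq (n + 1) x) fun i => hxr.1 _]
  exact (h r hr).ne' (hcount.image _).dimH_zero

end
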